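/- arXiv:2302.05620 — 3 statements merged into one kernel-verified Lean document; each statement's English description precedes it below -/
import Mathlib

section
/- Let f_1, …, f_T : ℝ^d → ℝ be differentiable functions, each convex on K and α-smooth on K, and for each t let x_t⋆ ∈ K be a minimizer of f_t over K. Let σ ∈ (0,1], let x_1 ∈ K, and for each t = 1, …, T−1 let v_t ∈ K be a linear-optimization step at x_t for f_t and set x_{t+1} = (1−σ)x_t + σv_t (the OFW algorithm with fixed step size σ). Let δ_2, …, δ_T be reals with |f_t(u) − f_{t−1}(u)| ≤ δ_t for all u ∈ K and all t = 2, …, T, and set V_T = Σ_{t=2}^T δ_t. Then Σ_{t=1}^T f_t(x_t) − Σ_{t=1}^T f_t(x_t⋆) ≤ (f_1(x_1) − f_T(x_T⋆) + V_T)/σ + ασ(T−1)D²/2. -/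
open RealInnerProductSpace Finset

section FirstOrder

variable {E : Type*} [NormedAddCommGroup E] [InnerProductSpace ℝ E] [CompleteSpace E]

/-- A convex function lies above its tangent at a point of differentiability. -/
lemma ConvexOn.add_inner_gradient_le {K : Set E} {f : E → ℝ} (hf : ConvexOn ℝ K f)
    {x y : E} (hx : x ∈ K) (hy : y ∈ K) (hd : DifferentiableAt ℝ f x) :
    f x + ⟪gradient f x, y - x⟫ ≤ f y := by
  have hconv := hf.comp_affineMap (AffineMap.lineMap x y : ℝ →ᵃ[ℝ] E)
  have hderiv : HasDerivAt (f ∘ AffineMap.lineMap x y) ⟪gradient f x, y - x⟫ (0 : ℝ) := by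
    have hline : HasDerivAt (AffineMap.lineMap x y : ℝ → E) (y - x) 0 :=
      AffineMap.hasDerivAt_lineMap
    have hgrad : HasFDerivAt f (InnerProductSpace.toDual ℝ E (gradient f x))
        (AffineMap.lineMap x y (0 : ℝ)) := by
      simpa using hd.hasGradientAt.hasFDerivAt
    simpa using hgrad.comp_hasDerivAt 0 hline
  have h := hconv.le_slope_of_hasDerivAt (x := 0) (y := 1) (by simpa using hx) (by simpa using hy)
    one_pos hderiv
  simp only [slope_def_field, Function.comp_apply, AffineMap.lineMap_apply_one,
    AffineMap.lineMap_apply_zero, sub_zero, div_one] at h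
  linarith

/-- The descent inequality of one Frank-Wolfe step with step size `σ`. -/
lemma frankWolfe_step_le {K : Set E} {f : E → ℝ} (hf : ConvexOn ℝ K f)
    {D α σ : ℝ} (hdiam : ∀ x ∈ K, ∀ y ∈ K, ‖x - y‖ ≤ D) (hα : 0 ≤ α)
    (hσ0 : 0 ≤ σ) (hσ1 : σ ≤ 1) {x v u : E}
    (hsmooth : ∀ y ∈ K, f y ≤ f x + ⟪gradient f x, y - x⟫ + α / 2 * ‖x - y‖ ^ 2)
    (hd : DifferentiableAt ℝ f x) (hx : x ∈ K) (hvK : v ∈ K) (hu : u ∈ K)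
    (hv : ⟪gradient f x, v⟫ ≤ ⟪gradient f x, u⟫) :
    f ((1 - σ) • x + σ • v) ≤ f x - σ * (f x - f u) + α * σ ^ 2 * D ^ 2 / 2 := by
  have hs := hsmooth _ (hf.1 hx hvK (sub_nonneg.2 hσ1) hσ0 (sub_add_cancel 1 σ))
  have hsub : (1 - σ) • x + σ • v - x = σ • (v - x) := by module
  have hnorm : ‖x - ((1 - σ) • x + σ • v)‖ = σ * ‖x - v‖ := by
    rw [show x - ((1 - σ) • x + σ • v) = σ • (x - v) by module, norm_smul,
      Real.norm_of_nonneg hσ0]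
  rw [hsub, hnorm, inner_smul_right] at hs
  have hlin : ⟪gradient f x, v - x⟫ ≤ f u - f x := by
    have := hf.add_inner_gradient_le hx hu hd
    rw [inner_sub_right] at this ⊢
    linarith
  have hquad : α / 2 * (σ * ‖x - v‖) ^ 2 ≤ α / 2 * (σ * D) ^ 2 := by
    gcongr
    exact hdiam x hx v hvK
  nlinarith [mul_le_mul_of_nonneg_left hlin hσ0]

end FirstOrder

/-- Theorem: dynamic regret of OFW with fixed step size for smooth functions. -/
theorem ofw_fixed_step_dynamic_regret
    {d T : ℕ} (hT : 1 ≤ T) {K : Set (EuclideanSpace ℝ (Fin d))}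
    (hKne : K.Nonempty) (hKconv : Convex ℝ K)
    {D : ℝ} (hD : 0 < D) (hdiam : ∀ x ∈ K, ∀ y ∈ K, ‖x - y‖ ≤ D)
    {α : ℝ} (hα : 0 < α)
    {f : ℕ → EuclideanSpace ℝ (Fin d) → ℝ}
    (hfdiff : ∀ t ∈ Finset.Icc 1 T, Differentiable ℝ (f t))
    (hfconv : ∀ t ∈ Finset.Icc 1 T, ConvexOn ℝ K (f t))
    (hfsmooth : ∀ t ∈ Finset.Icc 1 T, ∀ x ∈ K, ∀ y ∈ K,
      f t y ≤ f t x + ⟪gradient (f t) x, y - x⟫ + α / 2 * ‖x - y‖ ^ 2)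
    {xstar : ℕ → EuclideanSpace ℝ (Fin d)}
    (hxstarK : ∀ t ∈ Finset.Icc 1 T, xstar t ∈ K)
    (hxstar : ∀ t ∈ Finset.Icc 1 T, ∀ u ∈ K, f t (xstar t) ≤ f t u)
    {σ : ℝ} (hσ0 : 0 < σ) (hσ1 : σ ≤ 1)
    {x v : ℕ → EuclideanSpace ℝ (Fin d)} (hx1 : x 1 ∈ K)
    (hvK : ∀ t ∈ Finset.Icc 1 (T - 1), v t ∈ K)
    (hv : ∀ t ∈ Finset.Icc 1 (T - 1), ∀ u ∈ K,
      ⟪gradient (f t) (x t), v t⟫ ≤ ⟪gradient (f t) (x t), u⟫)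
    (hupd : ∀ t ∈ Finset.Icc 1 (T - 1), x (t + 1) = (1 - σ) • x t + σ • v t)
    {δ : ℕ → ℝ}
    (hδ : ∀ t ∈ Finset.Icc 2 T, ∀ u ∈ K, |f t u - f (t - 1) u| ≤ δ t) :
    ∑ t ∈ Finset.Icc 1 T, f t (x t) - ∑ t ∈ Finset.Icc 1 T, f t (xstar t) ≤
      (f 1 (x 1) - f T (xstar T) + ∑ t ∈ Finset.Icc 2 T, δ t) / σ
        + α * σ * ((T : ℝ) - 1) * D ^ 2 / 2 := by
  have key : ∀ n, 1 ≤ n → n ≤ T → x n ∈ K ∧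
      σ * ∑ t ∈ Finset.Ico 1 n, (f t (x t) - f t (xstar t)) ≤
        f 1 (x 1) - f n (x n) + ∑ t ∈ Finset.Icc 2 n, δ t
          + ((n : ℝ) - 1) * (α * σ ^ 2 * D ^ 2 / 2) := by
    intro n hn
    induction n, hn using Nat.le_induction with
    | base => simp [hx1]
    | succ n hn ih =>
      intro hnT
      obtain ⟨hxK, hsum⟩ := ih (by omega)
      have hmem : n ∈ Finset.Icc 1 T := Finset.mem_Icc.2 ⟨hn, by omega⟩
      have hmem' : n ∈ Finset.Icc 1 (T - 1) := Finset.mem_Icc.2 ⟨hn, by omega⟩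
      have hstep := frankWolfe_step_le (hfconv n hmem) hdiam hα.le hσ0.le hσ1
        (hfsmooth n hmem (x n) hxK) (hfdiff n hmem (x n)) hxK (hvK n hmem')
        (hxstarK n hmem) (hv n hmem' _ (hxstarK n hmem))
      have hxK' : x (n + 1) ∈ K := by
        rw [hupd n hmem']
        exact hKconv hxK (hvK n hmem') (sub_nonneg.2 hσ1) hσ0.le (sub_add_cancel 1 σ)
      rw [← hupd n hmem'] at hstep
      have hvar := (abs_le.1 (hδ (n + 1) (Finset.mem_Icc.2 ⟨by omega, hnT⟩) _ hxK')).2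
      rw [Nat.add_sub_cancel] at hvar
      refine ⟨hxK', ?_⟩
      rw [Finset.sum_Ico_succ_top hn, Finset.sum_Icc_succ_top (by omega)]
      push_cast
      linarith
  obtain ⟨hxK, hsum⟩ := key T hT le_rfl
  have hT' : T ∈ Finset.Icc 1 T := Finset.mem_Icc.2 ⟨hT, le_rfl⟩
  have hlast : σ * (f T (x T) - f T (xstar T)) ≤ f T (x T) - f T (xstar T) :=
    mul_le_of_le_one_left (sub_nonneg.2 (hxstar T hT' _ hxK)) hσ1
  have hsplit : ∑ t ∈ Finset.Icc 1 T, (f t (x t) - f t (xstar t)) =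
      ∑ t ∈ Finset.Ico 1 T, (f t (x t) - f t (xstar t)) + (f T (x T) - f T (xstar T)) := by
    rw [← Finset.sum_Ico_succ_top hT]
    rfl
  rw [← Finset.sum_sub_distrib, hsplit, ← sub_le_iff_le_add, le_div_iff₀ hσ0]
  linarith
end

section
/- Let f_1, …, f_T : ℝ^d → ℝ be differentiable functions, each convex on K, α-smooth on K, and β_f-strongly convex on K; for each t let x_t⋆ ∈ K be a minimizer of f_t over K such that the closed Euclidean ball of radius r > 0 around x_t⋆ is contained in K. Let x_1 ∈ K, and for each t = 1, …, T−1 let v_t ∈ K be a linear-optimization step at x_t for f_t, let σ_t ∈ [0,1] be a line-search step size at (x_t, v_t) for f_t, and set x_{t+1} = (1−σ_t)x_t + σ_t v_t (OFW with line search). Let M > 0 satisfy 2|f_t(u)| ≤ M for all t and all u ∈ K, set r̃ = min{r, √2·αD²/√(β_f·M)}, let δ_2, …, δ_T be reals with |f_t(u) − f_{t−1}(u)| ≤ δ_t for all u ∈ K, and set V_T = Σ_{t=2}^T δ_t. Then Σ_{t=1}^T f_t(x_t) − Σ_{t=1}^T f_t(x_t⋆) ≤ 4α(M + V_T)D²/(β_f·r̃²).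 -/
open RealInnerProductSpace Finset

section FrankWolfeStep

variable {E : Type*} [NormedAddCommGroup E] [InnerProductSpace ℝ E]

/-- The strong-convexity lower bound at `x` controls the gap by the squared gradient norm. -/
lemma two_mul_gap_le_norm_sq {β a b : ℝ} (hβ : 0 < β) {g x y : E}
    (h : a + ⟪g, y - x⟫ + β / 2 * ‖x - y‖ ^ 2 ≤ b) :
    2 * β * (a - b) ≤ ‖g‖ ^ 2 := by
  have h1 : -(‖g‖ * ‖x - y‖) ≤ ⟪g, y - x⟫ := by
    rw [norm_sub_rev]
    exact neg_le_of_abs_le (abs_real_inner_le_norm g (y - x))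
  have h2 : a - b ≤ ‖g‖ * ‖x - y‖ - β / 2 * ‖x - y‖ ^ 2 := by linarith
  have h3 := mul_le_mul_of_nonneg_left h2 (by positivity : 0 ≤ 2 * β)
  nlinarith [sq_nonneg (‖g‖ - β * ‖x - y‖)]

/-- A linear minimizer over a set containing a ball around `z` beats `z` by the radius times the
norm of the linear form. -/
lemma inner_le_sub_of_closedBall_subset {K : Set E} {g v z : E} {r s : ℝ} (hs : 0 ≤ s)
    (hsr : s ≤ r) (hball : Metric.closedBall z r ⊆ K) (hv : ∀ u ∈ K, ⟪g, v⟫ ≤ ⟪g, u⟫) :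
    ⟪g, v⟫ ≤ ⟪g, z⟫ - s * ‖g‖ := by
  rcases eq_or_ne g 0 with rfl | hg
  · simp
  have hg' : ‖g‖ ≠ 0 := norm_ne_zero_iff.mpr hg
  have hu : z - (s / ‖g‖) • g ∈ K := by
    apply hball
    rw [Metric.mem_closedBall, dist_eq_norm, sub_sub_cancel_left, norm_neg, norm_smul,
      Real.norm_of_nonneg (by positivity), div_mul_cancel₀ _ hg']
    exact hsr
  have h := hv _ hu
  rw [inner_sub_right, inner_smul_right, real_inner_self_eq_norm_sq] at h
  have : s / ‖g‖ * ‖g‖ ^ 2 = s * ‖g‖ := by field_simp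
  linarith

/-- If a set of diameter at most `D` contains a second point, a ball inside it has radius at
most `D`. -/
lemma radius_le_of_closedBall_subset {K : Set E} {D r : ℝ} {x z : E} (hr : 0 ≤ r)
    (hdiam : ∀ x ∈ K, ∀ y ∈ K, ‖x - y‖ ≤ D) (hz : z ∈ K)
    (hball : Metric.closedBall z r ⊆ K) (hxz : x ≠ z) : r ≤ D := by
  have hn : ‖x - z‖ ≠ 0 := norm_ne_zero_iff.mpr (sub_ne_zero.mpr hxz)
  have hnorm : ‖z + (r / ‖x - z‖) • (x - z) - z‖ = r := by
    rw [add_sub_cancel_left, norm_smul, Real.norm_of_nonneg (by positivity),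
      div_mul_cancel₀ _ hn]
  have hmem : z + (r / ‖x - z‖) • (x - z) ∈ K := by
    apply hball
    rw [Metric.mem_closedBall, dist_eq_norm, hnorm]
  exact hnorm ▸ hdiam _ hmem _ hz

end FrankWolfeStep

/-- Choosing the step `s * √(2βh) / (2αD²)` in the quadratic upper model decreases it by a fixed
fraction of `h`. -/
lemma exists_step_quadratic_le {α β D M s h p n G : ℝ} (hα : 0 < α) (hβ : 0 < β) (hD : 0 < D)
    (hM : 0 < M) (hs : 0 ≤ s) (hsM : s ≤ Real.sqrt 2 * α * D ^ 2 / Real.sqrt (β * M))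
    (hh : 0 ≤ h) (hhM : h ≤ M) (hG : 0 ≤ G) (hGh : 2 * β * h ≤ G ^ 2) (hp : p ≤ -(s * G))
    (hn : 0 ≤ n) (hnD : n ≤ D) :
    ∃ σ ∈ Set.Icc (0 : ℝ) 1, σ * p + α * σ ^ 2 / 2 * n ^ 2 ≤
      -(3 * (β * s ^ 2 / (4 * α * D ^ 2)) * h) := by
  set q := s * Real.sqrt (2 * β * h) with hq
  have hq0 : 0 ≤ q := by positivity
  have hq2 : q ^ 2 = s ^ 2 * (2 * β * h) := by
    rw [hq, mul_pow, Real.sq_sqrt (by positivity)]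
  have hpq : p ≤ -q := by
    have : Real.sqrt (2 * β * h) ≤ G := Real.sqrt_le_iff.mpr ⟨hG, hGh⟩
    nlinarith [mul_le_mul_of_nonneg_left this hs]
  have hs2 : s ^ 2 * (β * M) ≤ 2 * (α * D ^ 2) ^ 2 := by
    have h1 : s * Real.sqrt (β * M) ≤ Real.sqrt 2 * α * D ^ 2 :=
      (le_div_iff₀ (by positivity)).mp hsM
    have h2 := pow_le_pow_left₀ (by positivity) h1 2
    rw [mul_pow, Real.sq_sqrt (by positivity), mul_assoc, mul_pow,
      Real.sq_sqrt (by norm_num)] at h2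
    exact h2
  have hqle : q ≤ 2 * α * D ^ 2 := by
    refine (pow_le_pow_iff_left₀ hq0 (by positivity) two_ne_zero).mp ?_
    have : s ^ 2 * (β * h) ≤ s ^ 2 * (β * M) := by gcongr
    nlinarith
  have hn2 : n ^ 2 ≤ D ^ 2 := by gcongr
  refine ⟨q / (2 * α * D ^ 2), ⟨by positivity, (div_le_one (by positivity)).mpr hqle⟩, ?_⟩
  calc q / (2 * α * D ^ 2) * p + α * (q / (2 * α * D ^ 2)) ^ 2 / 2 * n ^ 2
      ≤ q / (2 * α * D ^ 2) * -q + α * (q / (2 * α * D ^ 2)) ^ 2 / 2 * D ^ 2 := by gcongr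
    _ = -(3 * q ^ 2 / (8 * α * D ^ 2)) := by field_simp; ring
    _ = _ := by rw [hq2]; field_simp; ring

/-- Telescoping a perturbed linear contraction. -/
lemma add_mul_sum_le_of_contraction {h δ : ℕ → ℝ} {ρ : ℝ} {T : ℕ}
    (hstep : ∀ t ∈ Finset.Icc 1 (T - 1), h (t + 1) ≤ h t - ρ * h t + 2 * δ (t + 1))
    (n : ℕ) (hn : 1 ≤ n) (hnT : n ≤ T) :
    h n + ρ * ∑ t ∈ Finset.Ico 1 n, h t ≤ h 1 + 2 * ∑ t ∈ Finset.Icc 2 n, δ t := by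
  induction n, hn using Nat.le_induction with
  | base => simp
  | succ n hn ih =>
    rw [Finset.sum_Ico_succ_top hn, Finset.sum_Icc_succ_top (by omega)]
    have := hstep n (Finset.mem_Icc.mpr ⟨hn, by omega⟩)
    have := ih (by omega)
    linarith

/-- Theorem 4: dynamic regret of OFW with line search for smooth and
strongly convex functions whose minimizers lie in the interior of the set. -/
theorem ofw_line_search_dynamic_regret_interior_minimizers
    {d T : ℕ} (hT : 1 ≤ T) {K : Set (EuclideanSpace ℝ (Fin d))}
    (hKne : K.Nonempty) (hKconv : Convex ℝ K)
    {D : ℝ} (hD : 0 < D) (hdiam : ∀ x ∈ K, ∀ y ∈ K, ‖x - y‖ ≤ D)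
    {α βf : ℝ} (hα : 0 < α) (hβf : 0 < βf)
    {f : ℕ → EuclideanSpace ℝ (Fin d) → ℝ}
    (hfdiff : ∀ t ∈ Finset.Icc 1 T, Differentiable ℝ (f t))
    (hfconv : ∀ t ∈ Finset.Icc 1 T, ConvexOn ℝ K (f t))
    (hfsmooth : ∀ t ∈ Finset.Icc 1 T, ∀ x ∈ K, ∀ y ∈ K,
      f t y ≤ f t x + ⟪gradient (f t) x, y - x⟫ + α / 2 * ‖x - y‖ ^ 2)
    (hfsc : ∀ t ∈ Finset.Icc 1 T, ∀ x ∈ K, ∀ y ∈ K,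
      f t x + ⟪gradient (f t) x, y - x⟫ + βf / 2 * ‖x - y‖ ^ 2 ≤ f t y)
    {xstar : ℕ → EuclideanSpace ℝ (Fin d)}
    (hxstarK : ∀ t ∈ Finset.Icc 1 T, xstar t ∈ K)
    (hxstar : ∀ t ∈ Finset.Icc 1 T, ∀ u ∈ K, f t (xstar t) ≤ f t u)
    {r : ℝ} (hr : 0 < r)
    (hball : ∀ t ∈ Finset.Icc 1 T, Metric.closedBall (xstar t) r ⊆ K)
    {x v : ℕ → EuclideanSpace ℝ (Fin d)} (hx1 : x 1 ∈ K)
    (hvK : ∀ t ∈ Finset.Icc 1 (T - 1), v t ∈ K)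
    (hv : ∀ t ∈ Finset.Icc 1 (T - 1), ∀ u ∈ K,
      ⟪gradient (f t) (x t), v t⟫ ≤ ⟪gradient (f t) (x t), u⟫)
    {σ : ℕ → ℝ} (hσ : ∀ t ∈ Finset.Icc 1 (T - 1), σ t ∈ Set.Icc (0 : ℝ) 1)
    (hls : ∀ t ∈ Finset.Icc 1 (T - 1), ∀ σ' ∈ Set.Icc (0 : ℝ) 1,
      σ t * ⟪gradient (f t) (x t), v t - x t⟫
          + α * (σ t) ^ 2 / 2 * ‖x t - v t‖ ^ 2 ≤
        σ' * ⟪gradient (f t) (x t), v t - x t⟫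
          + α * σ' ^ 2 / 2 * ‖x t - v t‖ ^ 2)
    (hupd : ∀ t ∈ Finset.Icc 1 (T - 1), x (t + 1) = (1 - σ t) • x t + σ t • v t)
    {M : ℝ} (hM : 0 < M) (hMbound : ∀ t ∈ Finset.Icc 1 T, ∀ u ∈ K, 2 * |f t u| ≤ M)
    {rtilde : ℝ}
    (hrtilde : rtilde = min r (Real.sqrt 2 * α * D ^ 2 / Real.sqrt (βf * M)))
    {δ : ℕ → ℝ}
    (hδ : ∀ t ∈ Finset.Icc 2 T, ∀ u ∈ K, |f t u - f (t - 1) u| ≤ δ t) :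
    ∑ t ∈ Finset.Icc 1 T, f t (x t) - ∑ t ∈ Finset.Icc 1 T, f t (xstar t) ≤
      4 * α * (M + ∑ t ∈ Finset.Icc 2 T, δ t) * D ^ 2 / (βf * rtilde ^ 2) := by
  have hrt : 0 < rtilde := by rw [hrtilde]; positivity
  have hrt_le : rtilde ≤ r := hrtilde ▸ min_le_left _ _
  have hrt_le' : rtilde ≤ Real.sqrt 2 * α * D ^ 2 / Real.sqrt (βf * M) :=
    hrtilde ▸ min_le_right _ _
  have hxK : ∀ t, 1 ≤ t → t ≤ T → x t ∈ K := by
    intro t ht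
    induction t, ht using Nat.le_induction with
    | base => exact fun _ => hx1
    | succ n hn ih =>
      intro hnT
      have hmem : n ∈ Finset.Icc 1 (T - 1) := Finset.mem_Icc.mpr ⟨hn, by omega⟩
      rw [hupd n hmem]
      exact hKconv (ih (by omega)) (hvK n hmem) (sub_nonneg.mpr (hσ n hmem).2) (hσ n hmem).1
        (by ring)
  set h : ℕ → ℝ := fun t => f t (x t) - f t (xstar t) with hh
  set c : ℝ := βf * rtilde ^ 2 / (4 * α * D ^ 2) with hc
  have hc0 : 0 < c := by positivity
  have h_nonneg : ∀ t ∈ Finset.Icc 1 T, 0 ≤ h t := fun t ht =>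
    sub_nonneg.mpr (hxstar t ht _ (hxK t (Finset.mem_Icc.mp ht).1 (Finset.mem_Icc.mp ht).2))
  have h_le : ∀ t ∈ Finset.Icc 1 T, h t ≤ M := by
    intro t ht
    have h1 := hMbound t ht _ (hxK t (Finset.mem_Icc.mp ht).1 (Finset.mem_Icc.mp ht).2)
    have h2 := hMbound t ht _ (hxstarK t ht)
    have h3 := le_abs_self (f t (x t))
    have h4 := neg_abs_le (f t (xstar t))
    simp only [hh]
    linarith
  have hδ_sum : 0 ≤ ∑ t ∈ Finset.Icc 2 T, δ t := by
    obtain ⟨u, hu⟩ := hKne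
    exact Finset.sum_nonneg fun t ht => (abs_nonneg _).trans (hδ t ht u hu)
  have hstep : ∀ t ∈ Finset.Icc 1 (T - 1),
      h (t + 1) ≤ h t - 3 * c * h t + 2 * δ (t + 1) := by
    intro t ht
    obtain ⟨ht1, htT⟩ := Finset.mem_Icc.mp ht
    have hm : t ∈ Finset.Icc 1 T := Finset.mem_Icc.mpr ⟨ht1, by omega⟩
    have hm' : t + 1 ∈ Finset.Icc 1 T := Finset.mem_Icc.mpr ⟨by omega, by omega⟩
    have hm2 : t + 1 ∈ Finset.Icc 2 T := Finset.mem_Icc.mpr ⟨by omega, by omega⟩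
    have hxt : x t ∈ K := hxK t ht1 (by omega)
    have hxt' : x (t + 1) ∈ K := hxK (t + 1) (by omega) (by omega)
    have hsc := hfsc t hm _ hxt _ (hxstarK t hm)
    have hgap := two_mul_gap_le_norm_sq hβf hsc
    have hlmo := inner_le_sub_of_closedBall_subset hrt.le hrt_le (hball t hm) (hv t ht)
    have hp : ⟪gradient (f t) (x t), v t - x t⟫ ≤ -(rtilde * ‖gradient (f t) (x t)‖) := by
      have h1 := h_nonneg t hm
      have h2 : 0 ≤ βf / 2 * ‖x t - xstar t‖ ^ 2 := by positivity
      simp only [hh] at h1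
      rw [inner_sub_right] at hsc ⊢
      linarith
    obtain ⟨s, hs, hsq⟩ := exists_step_quadratic_le hα hβf hD hM hrt.le hrt_le'
      (h_nonneg t hm) (h_le t hm) (norm_nonneg _) hgap hp (norm_nonneg (x t - v t))
      (hdiam _ hxt _ (hvK t ht))
    have hl := hls t ht s hs
    have hsm := hfsmooth t hm _ hxt _ hxt'
    have hdir : x (t + 1) - x t = σ t • (v t - x t) := by
      rw [hupd t ht]
      module
    rw [norm_sub_rev, hdir, inner_smul_right, norm_smul, mul_pow, Real.norm_eq_abs, sq_abs,
      norm_sub_rev (v t)] at hsm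
    have hd1 := (abs_le.mp (hδ _ hm2 _ hxt')).2
    have hd2 := (abs_le.mp (hδ _ hm2 _ (hxstarK _ hm'))).1
    have hmin := hxstar t hm _ (hxstarK _ hm')
    rw [Nat.add_sub_cancel] at hd1 hd2
    simp only [hh] at hsq ⊢
    linarith
  have hsum := add_mul_sum_le_of_contraction hstep T hT le_rfl
  have hTm : T ∈ Finset.Icc 1 T := Finset.mem_Icc.mpr ⟨hT, le_rfl⟩
  have h1M := h_le 1 (Finset.mem_Icc.mpr ⟨le_rfl, hT⟩)
  have hlast : 3 * c * h T ≤ h T := by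
    rcases eq_or_ne (x T) (xstar T) with he | hne
    · simp [hh, he]
    have hxT := hxK T hT le_rfl
    have hrD : rtilde ≤ D := hrt_le.trans
      (radius_le_of_closedBall_subset hr.le hdiam (hxstarK T hTm) (hball T hTm) hne)
    have hβα : βf ≤ α := by
      have h1 := hfsmooth T hTm _ hxT _ (hxstarK T hTm)
      have h2 := hfsc T hTm _ hxT _ (hxstarK T hTm)
      have h3 : 0 < ‖x T - xstar T‖ ^ 2 := by
        have := norm_pos_iff.mpr (sub_ne_zero.mpr hne)
        positivity
      have h4 : βf / 2 ≤ α / 2 := le_of_mul_le_mul_right (by linarith) h3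
      linarith
    have hc4 : c ≤ 1 / 4 := by
      rw [hc, div_le_iff₀ (by positivity)]
      calc βf * rtilde ^ 2 ≤ α * D ^ 2 := by gcongr
        _ = _ := by ring
    nlinarith [h_nonneg T hTm]
  have hkey : c * ∑ t ∈ Finset.Icc 1 T, h t ≤ M + ∑ t ∈ Finset.Icc 2 T, δ t := by
    rw [← Finset.Ico_insert_right hT, Finset.sum_insert (by simp)]
    linarith
  rw [← Finset.sum_sub_distrib]
  calc ∑ t ∈ Finset.Icc 1 T, h t ≤ (M + ∑ t ∈ Finset.Icc 2 T, δ t) / c := by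
        rw [le_div_iff₀ hc0, mul_comm]
        exact hkey
    _ = _ := by
        rw [hc]
        field_simp
end

section
/- Let f : ℝ^d → ℝ be differentiable, convex on K, α-smooth on K, and β_f-strongly convex on K. Let x⋆ ∈ K be a minimizer of f over K such that the closed Euclidean ball of radius r > 0 around x⋆ is contained in K. Let M > 0 satisfy 2|f(u)| ≤ M for all u ∈ K, and set r̃ = min{r, √2·αD²/√(β_f·M)} and C = 1 − β_f·r̃²/(4αD²). Let z^0 ∈ K and, for i = 0, …, N−1, let v^i ∈ K be a linear-optimization step at z^i for f, let σ^i ∈ [0,1] be a line-search step size at (z^i, v^i) for f, and set z^{i+1} = (1−σ^i)z^i + σ^i v^i. Then f(z^N) − f(x⋆) ≤ C^N · (f(z^0) − f(x⋆)). -/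
open RealInnerProductSpace

/-- A nonnegative sequence contracting by a factor `C` at each step decays geometrically; no sign
condition on `C` is needed. -/
lemma le_pow_mul_of_contracting {C : ℝ} {h : ℕ → ℝ} {N : ℕ} (hnonneg : ∀ i ≤ N, 0 ≤ h i)
    (hstep : ∀ i < N, h (i + 1) ≤ C * h i) : h N ≤ C ^ N * h 0 := by
  rcases le_or_gt 0 C with hC | hC
  · induction N with
    | zero => simp
    | succ n ih =>
      have hn := ih (fun i hi => hnonneg i (by omega)) (fun i hi => hstep i (by omega))
      calc h (n + 1) ≤ C * h n := hstep n (by omega)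
        _ ≤ C * (C ^ n * h 0) := by gcongr
        _ = C ^ (n + 1) * h 0 := by ring
  · have hzero : ∀ i < N, h i = 0 := fun i hi =>
      le_antisymm (nonpos_of_mul_nonneg_right ((hnonneg (i + 1) hi).trans (hstep i hi)) hC)
        (hnonneg i hi.le)
    cases N with
    | zero => simp
    | succ n =>
      have hlast := hstep n (by omega)
      rw [hzero n (by omega), mul_zero] at hlast
      rwa [hzero 0 (by omega), mul_zero]

section

variable {E : Type*} [NormedAddCommGroup E] [InnerProductSpace ℝ E]

/-- A minimizer `v` of the linear form `⟪g, ·⟫` over a set containing a closed ball of radius `r`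
around `x` improves on `x` by at least `r * ‖g‖`. -/
lemma mul_norm_le_inner_sub_of_closedBall_subset {K : Set E} {g v x : E} {r : ℝ} (hr : 0 ≤ r)
    (hball : Metric.closedBall x r ⊆ K) (hv : ∀ u ∈ K, ⟪g, v⟫ ≤ ⟪g, u⟫) :
    r * ‖g‖ ≤ ⟪g, x - v⟫ := by
  have hmem : x - (r / ‖g‖) • g ∈ K := by
    apply hball
    rw [mem_closedBall_iff_norm, sub_sub_cancel_left, norm_neg, norm_smul, Real.norm_eq_abs,
      abs_of_nonneg (by positivity)]
    rcases eq_or_ne ‖g‖ 0 with h0 | h0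
    · simpa [h0] using hr
    · exact (div_mul_cancel₀ r h0).le
  have hle := hv _ hmem
  rw [inner_sub_right, real_inner_smul_right, real_inner_self_eq_norm_sq] at hle
  have hcancel : r / ‖g‖ * ‖g‖ ^ 2 = r * ‖g‖ := by
    rcases eq_or_ne ‖g‖ 0 with h0 | h0
    · simp [h0]
    · field_simp
  rw [inner_sub_right]
  linarith

/-- The gradient-domination inequality implied by a strongly convex lower bound. -/
lemma two_mul_mul_le_norm_sq {g w : E} {β h : ℝ} (hβ : 0 < β)
    (hsc : h + β / 2 * ‖w‖ ^ 2 ≤ ⟪g, w⟫) : 2 * β * h ≤ ‖g‖ ^ 2 := by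
  have hcs := real_inner_le_norm g w
  nlinarith [sq_nonneg (‖g‖ - β * ‖w‖)]

end

/-- If the linear gain `G` is at least `ρ √(2βh)` and `ρ` is small, then some step size in
`[0, 1]` decreases the quadratic upper model by at least `β ρ² h / (4αD²)`. -/
lemma exists_step_size_decrease {α β D M ρ h G w : ℝ} (hα : 0 < α) (hβ : 0 < β) (hD : 0 < D)
    (hM : 0 < M) (hρ : 0 ≤ ρ) (hρle : ρ ≤ √2 * α * D ^ 2 / √(β * M)) (hh : 0 ≤ h) (hhM : h ≤ M)
    (hG : ρ * √(2 * β * h) ≤ G) (hw : 0 ≤ w) (hwD : w ≤ D) :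
    ∃ s ∈ Set.Icc (0 : ℝ) 1,
      β * ρ ^ 2 / (4 * α * D ^ 2) * h ≤ s * G - α * s ^ 2 / 2 * w ^ 2 := by
  set q := ρ * √(2 * β * h) with hq
  have hq0 : 0 ≤ q := by positivity
  have hqsq : q ^ 2 = ρ ^ 2 * (2 * β * h) := by rw [hq, mul_pow, Real.sq_sqrt (by positivity)]
  have hqle : q ≤ 2 * α * D ^ 2 := by
    calc q ≤ √2 * α * D ^ 2 / √(β * M) * √(2 * β * M) := by rw [hq]; gcongr
      _ = √2 * √2 * α * D ^ 2 * (√(β * M) / √(β * M)) := by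
        rw [mul_assoc 2 β M, Real.sqrt_mul zero_le_two]; ring
      _ = 2 * α * D ^ 2 := by
        rw [Real.mul_self_sqrt zero_le_two, div_self (by positivity), mul_one]
  refine ⟨q / (2 * α * D ^ 2), ⟨by positivity, div_le_one_of_le₀ hqle (by positivity)⟩, ?_⟩
  calc β * ρ ^ 2 / (4 * α * D ^ 2) * h = q ^ 2 / (8 * α * D ^ 2) := by
        rw [hqsq]; field_simp; ring
    _ ≤ 3 * q ^ 2 / (8 * α * D ^ 2) := by gcongr; nlinarith [sq_nonneg q]
    _ = q / (2 * α * D ^ 2) * q - α * (q / (2 * α * D ^ 2)) ^ 2 / 2 * D ^ 2 := by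
      field_simp; ring
    _ ≤ q / (2 * α * D ^ 2) * G - α * (q / (2 * α * D ^ 2)) ^ 2 / 2 * w ^ 2 := by gcongr

/-- Lemma 7: linear convergence of N Frank–Wolfe line-search iterations
for a smooth, strongly convex function whose minimizer lies in the interior of the set. -/
theorem fw_line_search_linear_convergence
    {d N : ℕ} {K : Set (EuclideanSpace ℝ (Fin d))}
    (hKne : K.Nonempty) (hKconv : Convex ℝ K)
    {D : ℝ} (hD : 0 < D) (hdiam : ∀ x ∈ K, ∀ y ∈ K, ‖x - y‖ ≤ D)
    {α βf : ℝ} (hα : 0 < α) (hβf : 0 < βf)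
    {f : EuclideanSpace ℝ (Fin d) → ℝ}
    (hfdiff : Differentiable ℝ f)
    (hfconv : ConvexOn ℝ K f)
    (hfsmooth : ∀ x ∈ K, ∀ y ∈ K,
      f y ≤ f x + ⟪gradient f x, y - x⟫ + α / 2 * ‖x - y‖ ^ 2)
    (hfsc : ∀ x ∈ K, ∀ y ∈ K,
      f x + ⟪gradient f x, y - x⟫ + βf / 2 * ‖x - y‖ ^ 2 ≤ f y)
    {xstar : EuclideanSpace ℝ (Fin d)}
    (hxstarK : xstar ∈ K) (hxstar : ∀ u ∈ K, f xstar ≤ f u)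
    {r : ℝ} (hr : 0 < r) (hball : Metric.closedBall xstar r ⊆ K)
    {M : ℝ} (hM : 0 < M) (hMbound : ∀ u ∈ K, 2 * |f u| ≤ M)
    {rtilde C : ℝ}
    (hrtilde : rtilde = min r (Real.sqrt 2 * α * D ^ 2 / Real.sqrt (βf * M)))
    (hC : C = 1 - βf * rtilde ^ 2 / (4 * α * D ^ 2))
    {z v : ℕ → EuclideanSpace ℝ (Fin d)} {σ : ℕ → ℝ}
    (hz0 : z 0 ∈ K)
    (hvK : ∀ i ∈ Finset.range N, v i ∈ K)
    (hv : ∀ i ∈ Finset.range N, ∀ u ∈ K,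
      ⟪gradient f (z i), v i⟫ ≤ ⟪gradient f (z i), u⟫)
    (hσ : ∀ i ∈ Finset.range N, σ i ∈ Set.Icc (0 : ℝ) 1)
    (hls : ∀ i ∈ Finset.range N, ∀ σ' ∈ Set.Icc (0 : ℝ) 1,
      σ i * ⟪gradient f (z i), v i - z i⟫ + α * (σ i) ^ 2 / 2 * ‖z i - v i‖ ^ 2 ≤
        σ' * ⟪gradient f (z i), v i - z i⟫ + α * σ' ^ 2 / 2 * ‖z i - v i‖ ^ 2)
    (hupd : ∀ i ∈ Finset.range N, z (i + 1) = (1 - σ i) • z i + σ i • v i) :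
    f (z N) - f xstar ≤ C ^ N * (f (z 0) - f xstar) := by
  have hzK : ∀ i ≤ N, z i ∈ K := by
    intro i
    induction i with
    | zero => exact fun _ => hz0
    | succ i ih =>
      intro hi
      have hiN := Finset.mem_range.2 hi
      rw [hupd i hiN]
      exact hKconv (ih (by omega)) (hvK i hiN) (by linarith [(hσ i hiN).2]) (hσ i hiN).1
        (by ring)
  refine le_pow_mul_of_contracting (h := fun i => f (z i) - f xstar)
    (fun i hi => sub_nonneg.2 (hxstar _ (hzK i hi))) fun i hi => ?_
  have hiN := Finset.mem_range.2 hi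
  have hziK := hzK i hi.le
  have hh : 0 ≤ f (z i) - f xstar := sub_nonneg.2 (hxstar _ hziK)
  have hhM : f (z i) - f xstar ≤ M := by
    linarith [hMbound _ hziK, hMbound _ hxstarK, le_abs_self (f (z i)), neg_abs_le (f xstar)]
  have hρ : 0 ≤ rtilde := by rw [hrtilde]; positivity
  have hsc : f (z i) - f xstar + βf / 2 * ‖z i - xstar‖ ^ 2
      ≤ ⟪gradient f (z i), z i - xstar⟫ := by
    have := hfsc _ hziK _ hxstarK
    rw [← neg_sub (z i) xstar, inner_neg_right] at this
    linarith
  have hG : rtilde * √(2 * βf * (f (z i) - f xstar)) ≤ ⟪gradient f (z i), z i - v i⟫ := by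
    calc rtilde * √(2 * βf * (f (z i) - f xstar)) ≤ r * ‖gradient f (z i)‖ := by
          gcongr
          · rw [hrtilde]; exact min_le_left _ _
          · exact Real.sqrt_le_iff.2 ⟨norm_nonneg _, two_mul_mul_le_norm_sq hβf hsc⟩
      _ ≤ ⟪gradient f (z i), xstar - v i⟫ :=
        mul_norm_le_inner_sub_of_closedBall_subset hr.le hball (hv i hiN)
      _ ≤ ⟪gradient f (z i), z i - v i⟫ := by
        rw [← sub_add_sub_cancel (z i) xstar (v i), inner_add_right]
        have : 0 ≤ βf / 2 * ‖z i - xstar‖ ^ 2 := by positivity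
        linarith
  obtain ⟨s, hs, hdec⟩ := exists_step_size_decrease hα hβf hD hM hρ
    (by rw [hrtilde]; exact min_le_right _ _) hh hhM hG (norm_nonneg (z i - v i))
    (hdiam _ hziK _ (hvK i hiN))
  have hmodel := hls i hiN s hs
  have hsmooth := hfsmooth _ hziK _ (hzK (i + 1) hi)
  have hdir : z (i + 1) - z i = σ i • (v i - z i) := by rw [hupd i hiN]; module
  rw [norm_sub_rev, hdir, inner_smul_right, norm_smul, mul_pow, Real.norm_eq_abs, sq_abs,
    norm_sub_rev (v i)] at hsmooth
  rw [← neg_sub (v i) (z i), inner_neg_right] at hdec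
  rw [norm_neg, norm_sub_rev (v i)] at hdec
  simp only [hC]
  linarith
end
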